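/- arXiv:1502.02379 — 2 statements merged into one kernel-verified Lean document; each statement's English description precedes it below -/
import Mathlib

section
/- For λ > -1/2 and ν > 0 and every x ∈ [-1,1] and n ≥ 0: Z_n^{λ}(x) = c_ν · σ_{λ+1,ν} · ∫_{-1}^{1} ∫_{0}^{1} Z_n^{λ+ν}( u v + (1-u) x ) u^{ν-1} (1-u)^{λ} du (1 - v^2)^{ν - 1/2} dv, where σ_{λ,ν} = Γ(λ+ν)/(Γ(λ)Γ(ν)) and c_ν = Γ(ν+1)/(Γ(1/2)Γ(ν+1/2)). -/
open Real MeasureTheory Set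

/-- Pochhammer symbol `(a)_n = a (a+1) ⋯ (a+n-1)`. -/
noncomputable def poch (a : ℝ) (n : ℕ) : ℝ := ∏ i ∈ Finset.range n, (a + i)

/-- Jacobi polynomial `P_n^{(a,b)}(x)`, normalized by `P_n^{(a,b)}(1) = (a+1)_n / n!`. -/
noncomputable def jacobiP (n : ℕ) (a b x : ℝ) : ℝ :=
  ∑ k ∈ Finset.range (n + 1),
    (poch (a + k + 1) (n - k) * poch (a + b + n + 1) k) /
      ((Nat.factorial k : ℝ) * (Nat.factorial (n - k) : ℝ)) * ((x - 1) / 2) ^ k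

/-- Gegenbauer polynomial `C_n^{λ}(x)`. -/
noncomputable def gegenbauerC (n : ℕ) (l x : ℝ) : ℝ :=
  ∑ k ∈ Finset.range (n / 2 + 1),
    (-1 : ℝ) ^ k * poch l (n - k) /
      ((Nat.factorial k : ℝ) * (Nat.factorial (n - 2 * k) : ℝ)) * (2 * x) ^ (n - 2 * k)

/-- `Z_n^λ(x) = ((n+λ)/λ) C_n^λ(x)`, extended analytically in `λ` through `λ = 0`. -/
noncomputable def gegenbauerZ (n : ℕ) (l x : ℝ) : ℝ :=
  if n = 0 then 1 else
  ∑ k ∈ Finset.range (n / 2 + 1),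
    (-1 : ℝ) ^ k * ((n : ℝ) + l) * poch (l + 1) (n - k - 1) /
      ((Nat.factorial k : ℝ) * (Nat.factorial (n - 2 * k) : ℝ)) * (2 * x) ^ (n - 2 * k)

@[simp] lemma poch_zero (a : ℝ) : poch a 0 = 1 := by simp [poch]

lemma poch_succ (a : ℝ) (n : ℕ) : poch a (n + 1) = poch a n * (a + n) := by
  simp [poch, Finset.prod_range_succ]

lemma poch_add (a : ℝ) (m n : ℕ) : poch a (m + n) = poch a m * poch (a + m) n := by
  simp [poch, Finset.prod_range_add, add_assoc]

lemma poch_pos {a : ℝ} (ha : 0 < a) (n : ℕ) : 0 < poch a n :=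
  Finset.prod_pos fun i _ => by positivity

lemma Gamma_add_natCast {a : ℝ} (ha : 0 < a) (n : ℕ) :
    Real.Gamma (a + n) = poch a n * Real.Gamma a := by
  induction n with
  | zero => simp
  | succ n ih =>
    have h : a + n ≠ 0 := by positivity
    rw [Nat.cast_succ, ← add_assoc, Real.Gamma_add_one h, ih, poch_succ]
    ring

lemma ofReal_betaIntegrand {a b u : ℝ} (hu : u ∈ Ioc (0 : ℝ) 1) :
    ((u ^ (a - 1) * (1 - u) ^ (b - 1) : ℝ) : ℂ) =
      (u : ℂ) ^ ((a : ℂ) - 1) * (1 - (u : ℂ)) ^ ((b : ℂ) - 1) := by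
  rw [Complex.ofReal_mul, Complex.ofReal_cpow hu.1.le, Complex.ofReal_cpow (sub_nonneg.2 hu.2)]
  push_cast
  rfl

lemma intervalIntegrable_beta {a b : ℝ} (ha : 0 < a) (hb : 0 < b) :
    IntervalIntegrable (fun u : ℝ => u ^ (a - 1) * (1 - u) ^ (b - 1)) volume 0 1 := by
  have h := Complex.betaIntegral_convergent (u := a) (v := b) (by simpa) (by simpa)
  rw [intervalIntegrable_iff_integrableOn_Ioc_of_le zero_le_one] at h ⊢
  refine (IntegrableOn.congr_fun h.re (fun u hu => ?_) measurableSet_Ioc)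
  simp only [← ofReal_betaIntegrand hu]
  exact Complex.ofReal_re _

lemma integral_beta {a b : ℝ} (ha : 0 < a) (hb : 0 < b) :
    ∫ u in (0 : ℝ)..1, u ^ (a - 1) * (1 - u) ^ (b - 1) =
      Real.Gamma a * Real.Gamma b / Real.Gamma (a + b) := by
  have h := ProbabilityTheory.beta_eq_betaIntegralReal a b ha hb
  rw [ProbabilityTheory.beta] at h
  rw [h, ← Complex.ofReal_re (∫ u in (0 : ℝ)..1, _), ← intervalIntegral.integral_ofReal,
    Complex.betaIntegral]
  congr 1
  refine intervalIntegral.integral_congr_ae (Filter.Eventually.of_forall fun u hu => ?_)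
  rw [uIoc_of_le zero_le_one] at hu
  exact ofReal_betaIntegrand hu

lemma integral_beta_moment {a b : ℝ} (ha : 0 < a) (hb : 0 < b) (j k : ℕ) :
    ∫ u in (0 : ℝ)..1, u ^ j * (1 - u) ^ k * (u ^ (a - 1) * (1 - u) ^ (b - 1)) =
      Real.Gamma a * Real.Gamma b / Real.Gamma (a + b) *
        (poch a j * poch b k / poch (a + b) (j + k)) := by
  have h : ∫ u in (0 : ℝ)..1, u ^ j * (1 - u) ^ k * (u ^ (a - 1) * (1 - u) ^ (b - 1)) =
      ∫ u in (0 : ℝ)..1, u ^ ((a + j) - 1) * (1 - u) ^ ((b + k) - 1) := by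
    refine intervalIntegral.integral_congr_Ioo_of_le zero_le_one fun u hu => ?_
    have h1 : (0 : ℝ) < u := hu.1
    have h2 : 0 < 1 - u := sub_pos.2 hu.2
    simp only [add_sub_right_comm, Real.rpow_add h1, Real.rpow_add h2, Real.rpow_natCast]
    ring
  rw [h, integral_beta (by positivity) (by positivity),
    show a + j + (b + k) = a + b + ((j + k : ℕ) : ℝ) by push_cast; ring,
    Gamma_add_natCast ha, Gamma_add_natCast hb, Gamma_add_natCast (add_pos ha hb)]
  ring

lemma intervalIntegrable_one_sub_sq_rpow {s : ℝ} (hs : -1 < s) :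
    IntervalIntegrable (fun v : ℝ => (1 - v ^ 2) ^ s) volume (-1) 1 := by
  have h := (((intervalIntegrable_beta (a := s + 1) (b := s + 1) (by linarith)
    (by linarith)).comp_add_right (1 / 2)).comp_mul_right (c := 1 / 2) (by norm_num)).const_mul
      (4 ^ s)
  norm_num at h
  rw [intervalIntegrable_iff_integrableOn_Ioo_of_le (by norm_num)] at h ⊢
  refine h.congr_fun (fun v hv => ?_) measurableSet_Ioo
  have h1 : 0 < 1 + v := by linarith [hv.1]
  have h2 : 0 < 1 - v := by linarith [hv.2]
  simp only
  rw [← Real.mul_rpow (by linarith) (by linarith), ← Real.mul_rpow (by norm_num) (by nlinarith)]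
  congr 1
  ring

lemma integral_one_sub_sq_rpow {ν : ℝ} (hν : 0 < ν) :
    ∫ v in (-1 : ℝ)..1, (1 - v ^ 2) ^ (ν - 1 / 2) =
      Real.Gamma (1 / 2) * Real.Gamma (ν + 1 / 2) / Real.Gamma (ν + 1) := by
  have h1 := integral_beta (a := ν + 1 / 2) (b := ν + 1 / 2) (by positivity) (by positivity)
  have h2 := intervalIntegral.integral_comp_mul_add (a := (-1 : ℝ)) (b := 1) (c := 1 / 2)
    (fun u : ℝ => u ^ (ν + 1 / 2 - 1) * (1 - u) ^ (ν + 1 / 2 - 1)) (by norm_num) (1 / 2)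
  norm_num at h2
  have h3 : ∫ v in (-1 : ℝ)..1, (1 - v ^ 2) ^ (ν - 1 / 2) =
      4 ^ (ν - 1 / 2) * ∫ v in (-1 : ℝ)..1, (1 / 2 * v + 1 / 2) ^ (ν + 1 / 2 - 1) *
        (1 - (1 / 2 * v + 1 / 2)) ^ (ν + 1 / 2 - 1) := by
    rw [← intervalIntegral.integral_const_mul]
    refine intervalIntegral.integral_congr_Ioo_of_le (by norm_num) fun v hv => ?_
    have h1 : 0 < 1 + v := by linarith [hv.1]
    have h2 : 0 < 1 - v := by linarith [hv.2]
    rw [← Real.mul_rpow (by linarith) (by linarith), show ν + 1 / 2 - 1 = ν - 1 / 2 by ring,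
      ← Real.mul_rpow (by norm_num) (by nlinarith)]
    congr 1
    ring
  have h4 := Real.Gamma_mul_Gamma_add_half (ν + 1 / 2)
  have h5 : (2 : ℝ) ^ (1 - 2 * (ν + 1 / 2)) * (4 ^ (ν - 1 / 2) * 2) = 1 := by
    rw [show (4 : ℝ) = 2 ^ (2 : ℝ) by norm_num, ← Real.rpow_mul (by norm_num)]
    rw [← Real.rpow_add_one (by norm_num), ← Real.rpow_add (by norm_num),
      show 1 - 2 * (ν + 1 / 2) + (2 * (ν - 1 / 2) + 1) = 0 by ring, Real.rpow_zero]
  have h6 : 0 < Real.Gamma (ν + 1) := Real.Gamma_pos_of_pos (by positivity)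
  have h7 : 0 < Real.Gamma (2 * (ν + 1 / 2)) := Real.Gamma_pos_of_pos (by positivity)
  rw [show ν + 1 / 2 + 1 / 2 = ν + 1 by ring] at h4
  rw [h3, h2, h1, ← two_mul (ν + 1 / 2), Real.Gamma_one_half_eq, ← mul_assoc,
    mul_div_assoc', div_eq_div_iff h7.ne' h6.ne']
  linear_combination (4 ^ (ν - 1 / 2) * 2) * Real.Gamma (ν + 1 / 2) * h4 +
    Real.Gamma (ν + 1 / 2) * Real.Gamma (2 * (ν + 1 / 2)) * √π * h5

lemma intervalIntegrable_pow_mul_one_sub_sq_rpow {s : ℝ} (hs : -1 < s) (m : ℕ) :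
    IntervalIntegrable (fun v : ℝ => v ^ m * (1 - v ^ 2) ^ s) volume (-1) 1 :=
  (intervalIntegrable_one_sub_sq_rpow hs).continuousOn_mul (by fun_prop)

lemma hasDerivAt_pow_mul_one_sub_sq_rpow {ν v : ℝ} (hv : v ∈ Ioo (-1 : ℝ) 1) (m : ℕ) :
    HasDerivAt (fun v : ℝ => v ^ m * (1 - v ^ 2) ^ (ν + 1 / 2))
      (m * (v ^ (m - 1) * (1 - v ^ 2) ^ (ν + 1 / 2)) -
        (2 * ν + 1) * (v ^ (m + 1) * (1 - v ^ 2) ^ (ν - 1 / 2))) v := by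
  have h : 0 < 1 - v ^ 2 := by nlinarith [hv.1, hv.2]
  have h1 : HasDerivAt (fun v : ℝ => 1 - v ^ 2) (-(2 * v)) v := by
    simpa using (hasDerivAt_pow 2 v).const_sub 1
  convert! (hasDerivAt_pow m v).mul (h1.rpow_const (p := ν + 1 / 2) (Or.inl h.ne')) using 1
  rw [show ν + 1 / 2 - 1 = ν - 1 / 2 by ring]
  ring

lemma integral_pow_mul_one_sub_sq_rpow_add_one {ν : ℝ} (hν : 0 < ν) (m : ℕ) :
    m * (∫ v in (-1 : ℝ)..1, v ^ (m - 1) * (1 - v ^ 2) ^ (ν + 1 / 2)) =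
      (2 * ν + 1) * ∫ v in (-1 : ℝ)..1, v ^ (m + 1) * (1 - v ^ 2) ^ (ν - 1 / 2) := by
  have i1 := intervalIntegrable_pow_mul_one_sub_sq_rpow (s := ν + 1 / 2) (by linarith) (m - 1)
  have i2 := intervalIntegrable_pow_mul_one_sub_sq_rpow (s := ν - 1 / 2) (by linarith) (m + 1)
  have h := intervalIntegral.integral_eq_sub_of_hasDerivAt_of_le (a := -1) (b := 1) (by norm_num)
    (f := fun v : ℝ => v ^ m * (1 - v ^ 2) ^ (ν + 1 / 2))
    (ContinuousOn.mul (by fun_prop) (ContinuousOn.rpow_const (by fun_prop)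
      fun _ _ => Or.inr (by positivity)))
    (fun v hv => hasDerivAt_pow_mul_one_sub_sq_rpow hv m)
    ((i1.const_mul m).sub (i2.const_mul (2 * ν + 1)))
  rw [intervalIntegral.integral_sub (i1.const_mul _) (i2.const_mul _),
    intervalIntegral.integral_const_mul, intervalIntegral.integral_const_mul] at h
  have h0 : (0 : ℝ) ^ (ν + 1 / 2) = 0 := Real.zero_rpow (by positivity)
  norm_num [h0] at h ⊢
  linarith

lemma integral_pow_add_two_mul_one_sub_sq_rpow {ν : ℝ} (hν : 0 < ν) (m : ℕ) :
    (m + 2 * ν + 2) * ∫ v in (-1 : ℝ)..1, v ^ (m + 2) * (1 - v ^ 2) ^ (ν - 1 / 2) =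
      (m + 1) * ∫ v in (-1 : ℝ)..1, v ^ m * (1 - v ^ 2) ^ (ν - 1 / 2) := by
  have i1 := intervalIntegrable_pow_mul_one_sub_sq_rpow (s := ν - 1 / 2) (by linarith) m
  have i2 := intervalIntegrable_pow_mul_one_sub_sq_rpow (s := ν - 1 / 2) (by linarith) (m + 2)
  have h := integral_pow_mul_one_sub_sq_rpow_add_one hν (m + 1)
  have h1 : ∫ v in (-1 : ℝ)..1, v ^ m * (1 - v ^ 2) ^ (ν + 1 / 2) =
      (∫ v in (-1 : ℝ)..1, v ^ m * (1 - v ^ 2) ^ (ν - 1 / 2)) -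
        ∫ v in (-1 : ℝ)..1, v ^ (m + 2) * (1 - v ^ 2) ^ (ν - 1 / 2) := by
    rw [← intervalIntegral.integral_sub i1 i2]
    refine intervalIntegral.integral_congr_Ioo_of_le (by norm_num) fun v hv => ?_
    have h : 0 < 1 - v ^ 2 := by nlinarith [hv.1, hv.2]
    rw [show ν + 1 / 2 = ν - 1 / 2 + 1 by ring, Real.rpow_add_one h.ne']
    ring
  rw [Nat.add_sub_cancel, h1] at h
  push_cast at h
  linear_combination -h

lemma integral_pow_odd_mul_one_sub_sq_rpow {ν : ℝ} (hν : 0 < ν) (i : ℕ) :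
    ∫ v in (-1 : ℝ)..1, v ^ (2 * i + 1) * (1 - v ^ 2) ^ (ν - 1 / 2) = 0 := by
  induction i with
  | zero =>
    have h := integral_pow_mul_one_sub_sq_rpow_add_one hν 0
    rw [Nat.cast_zero, zero_mul] at h
    exact (mul_eq_zero.1 h.symm).resolve_left (by positivity)
  | succ i ih =>
    have h := integral_pow_add_two_mul_one_sub_sq_rpow hν (2 * i + 1)
    rw [ih, mul_zero] at h
    exact (mul_eq_zero.1 h).resolve_left (by positivity)

lemma integral_pow_even_mul_one_sub_sq_rpow {ν : ℝ} (hν : 0 < ν) (i : ℕ) :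
    ∫ v in (-1 : ℝ)..1, v ^ (2 * i) * (1 - v ^ 2) ^ (ν - 1 / 2) =
      Real.Gamma (1 / 2) * Real.Gamma (ν + 1 / 2) / Real.Gamma (ν + 1) *
        (poch (1 / 2) i / poch (ν + 1) i) := by
  induction i with
  | zero => simpa using integral_one_sub_sq_rpow hν
  | succ i ih =>
    have h := integral_pow_add_two_mul_one_sub_sq_rpow hν (2 * i)
    have h1 : (↑(2 * i) + 2 * ν + 2 : ℝ) ≠ 0 := by positivity
    refine mul_left_cancel₀ h1 ?_
    rw [mul_add_one 2 i, h, ih, poch_succ, poch_succ]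
    have h2 := (poch_pos (by positivity : 0 < ν + 1) i).ne'
    have h3 : ν + 1 + i ≠ 0 := by positivity
    push_cast
    field_simp
    ring
/-- The Rothe coefficient `a / (a + 2 * k) * (a + 2 * k).choose k`, the coefficient of `z ^ k` in
`B z ^ a` for the Catalan generating function `B`. -/
noncomputable def rothe (a : ℝ) : ℕ → ℝ
  | 0 => 1
  | k + 1 => a * poch (a + k + 2) k / (k + 1).factorial

@[simp] lemma rothe_zero_right (a : ℝ) : rothe a 0 = 1 := rfl

lemma rothe_succ (a : ℝ) (k : ℕ) :
    rothe a (k + 1) = a * poch (a + k + 2) k / (k + 1).factorial := rfl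

lemma rothe_zero_succ (k : ℕ) : rothe 0 (k + 1) = 0 := by simp [rothe_succ]

lemma poch_succ_left (a : ℝ) (n : ℕ) : poch a (n + 1) = a * poch (a + 1) n := by
  rw [add_comm n, poch_add, poch_succ]
  simp

lemma rothe_add_one (a : ℝ) (k : ℕ) :
    rothe (a + 1) (k + 1) = rothe a (k + 1) + rothe (a + 2) k := by
  cases k with
  | zero => simp [rothe_succ]
  | succ k =>
    have h1 : poch (a + 1 + ((k + 1 : ℕ) : ℝ) + 2) (k + 1) =
        poch (a + k + 4) k * (a + 2 * k + 4) := by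
      rw [poch_succ]; push_cast; ring_nf
    have h2 : poch (a + ((k + 1 : ℕ) : ℝ) + 2) (k + 1) = (a + k + 3) * poch (a + k + 4) k := by
      rw [poch_succ_left]; push_cast; ring_nf
    have h3 : a + 2 + k + 2 = a + k + 4 := by ring
    rw [rothe_succ, rothe_succ, rothe_succ, h1, h2, h3, Nat.factorial_succ (k + 1)]
    have := Nat.cast_ne_zero (R := ℝ).2 (Nat.factorial_ne_zero (k + 1))
    push_cast
    field_simp
    ring

lemma exists_polynomial_eval_eq_rothe (k : ℕ) :
    ∃ P : Polynomial ℝ, ∀ a, P.eval a = rothe a k := by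
  cases k with
  | zero => exact ⟨1, by simp⟩
  | succ k =>
    refine ⟨Polynomial.X * (∏ i ∈ Finset.range k,
      (Polynomial.X + Polynomial.C (k + 2 + i : ℝ))) * Polynomial.C (((k + 1).factorial : ℝ)⁻¹),
      fun a => ?_⟩
    simp [rothe_succ, poch, Polynomial.eval_prod, div_eq_mul_inv, add_assoc]

lemma sum_rothe_add_one (a b : ℝ) (s : ℕ) :
    ∑ p ∈ Finset.HasAntidiagonal.antidiagonal (s + 1), rothe (a + 1) p.1 * rothe b p.2 =
      ∑ p ∈ Finset.HasAntidiagonal.antidiagonal (s + 1), rothe a p.1 * rothe b p.2 +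
        ∑ p ∈ Finset.HasAntidiagonal.antidiagonal s, rothe (a + 2) p.1 * rothe b p.2 := by
  simp only [Finset.Nat.sum_antidiagonal_succ, rothe_add_one, rothe_zero_right, add_mul,
    Finset.sum_add_distrib]
  ring

/-- The Rothe–Hagen convolution identity. -/
theorem sum_rothe_mul_rothe (s : ℕ) (a b : ℝ) :
    ∑ p ∈ Finset.HasAntidiagonal.antidiagonal s, rothe a p.1 * rothe b p.2 = rothe (a + b) s := by
  induction s generalizing a b with
  | zero => simp
  | succ s ih =>
    have hnat (m : ℕ) :
        ∑ p ∈ Finset.HasAntidiagonal.antidiagonal (s + 1), rothe m p.1 * rothe b p.2 =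
        rothe (m + b) (s + 1) := by
      induction m with
      | zero => simp [Finset.Nat.sum_antidiagonal_succ, rothe_zero_succ]
      | succ m ihm =>
        rw [Nat.cast_succ, sum_rothe_add_one, ihm, ih, add_right_comm, add_right_comm (m : ℝ) 1,
          rothe_add_one]
    choose P hP using exists_polynomial_eval_eq_rothe
    have h : ∑ p ∈ Finset.HasAntidiagonal.antidiagonal (s + 1), P p.1 * Polynomial.C (rothe b p.2) =
        (P (s + 1)).comp (Polynomial.X + Polynomial.C b) := by
      refine Polynomial.eq_of_infinite_eval_eq _ _
        ((infinite_range_of_injective Nat.cast_injective).mono (s := range ((↑) : ℕ → ℝ)) ?_)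
      rintro _ ⟨m, rfl⟩
      simp [Polynomial.eval_finsetSum, hP, hnat]
    simpa [Polynomial.eval_finsetSum, hP] using congrArg (Polynomial.eval a) h

lemma poch_neg (a : ℝ) (k : ℕ) : poch (-a) k = (-1) ^ k * poch (a - k + 1) k := by
  induction k generalizing a with
  | zero => simp
  | succ k ih =>
    rw [poch_succ_left, poch_succ, show -a + 1 = -(a - 1) by ring, ih]
    push_cast
    ring_nf

lemma poch_mul_rothe_neg {n k : ℕ} (hn : n ≠ 0) (hk : 2 * k ≤ n) (l : ℝ) :
    poch (l + 1) (n - 2 * k) * rothe (-(n + l)) k =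
      (-1) ^ k * (n + l) * poch (l + 1) (n - k - 1) / k.factorial := by
  cases k with
  | zero =>
    obtain ⟨n, rfl⟩ := Nat.exists_eq_succ_of_ne_zero hn
    simp [poch_succ]
    ring
  | succ k =>
    obtain ⟨m, rfl⟩ := Nat.exists_eq_add_of_le' hk
    rw [Nat.add_sub_cancel, show m + 2 * (k + 1) - (k + 1) - 1 = m + k by omega, poch_add,
      rothe_succ, show -(((m + 2 * (k + 1) : ℕ) : ℝ) + l) + k + 2 = -(m + k + l) by push_cast; ring,
      poch_neg, show (m : ℝ) + k + l - k + 1 = l + 1 + m by ring]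
    ring

lemma gegenbauerZ_eq_sum_rothe (n : ℕ) (l x : ℝ) :
    gegenbauerZ n l x = ∑ k ∈ Finset.range (n / 2 + 1),
      poch (l + 1) (n - 2 * k) * rothe (-(n + l)) k / (n - 2 * k).factorial *
        (2 * x) ^ (n - 2 * k) := by
  rcases eq_or_ne n 0 with rfl | hn
  · simp [gegenbauerZ]
  rw [gegenbauerZ, if_neg hn]
  refine Finset.sum_congr rfl fun k hk => ?_
  rw [Finset.mem_range] at hk
  rw [poch_mul_rothe_neg hn (by omega), div_div]

lemma poch_one_half_mul (i : ℕ) :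
    poch (1 / 2) i * (4 ^ i * i.factorial) = (2 * i).factorial := by
  induction i with
  | zero => simp
  | succ i ih =>
    rw [mul_add_one 2 i, Nat.factorial_succ, Nat.factorial_succ, Nat.factorial_succ, poch_succ]
    push_cast
    rw [← ih]
    ring

lemma poch_two_mul_mul_poch_one_half (ν : ℝ) (i : ℕ) :
    poch ν (2 * i) * poch (1 / 2) i * 4 ^ i =
      rothe ν i * poch (ν + 1) i * (2 * i).factorial := by
  cases i with
  | zero => simp
  | succ i =>
    rw [← poch_one_half_mul, rothe_succ, show 2 * (i + 1) = (i + 1 + i) + 1 by ring,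
      poch_succ_left, poch_add, show ν + 1 + ((i + 1 : ℕ) : ℝ) = ν + i + 2 by push_cast; ring]
    field_simp

lemma sum_range_eq_sum_even {f : ℕ → ℝ} (hf : ∀ i, f (2 * i + 1) = 0) (m : ℕ) :
    ∑ j ∈ Finset.range (m + 1), f j = ∑ i ∈ Finset.range (m / 2 + 1), f (2 * i) := by
  induction m with
  | zero => simp
  | succ m ih =>
    rw [Finset.sum_range_succ, ih]
    rcases Nat.even_or_odd' m with ⟨c, rfl | rfl⟩
    · rw [hf, show (2 * c + 1) / 2 = 2 * c / 2 by omega, add_zero]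
    · rw [show (2 * c + 1 + 1) / 2 = (2 * c + 1) / 2 + 1 by omega,
        Finset.sum_range_succ _ ((2 * c + 1) / 2 + 1)]
      congr 2
      omega

/-- The coefficient of `v ^ j` in the average of `(u * v + (1 - u) * x) ^ m` against the
normalized beta weight `u ^ (ν - 1) * (1 - u) ^ l`. -/
noncomputable def betaMomentCoeff (l ν x : ℝ) (m j : ℕ) : ℝ :=
  m.choose j * x ^ (m - j) * (poch ν j * poch (l + 1) (m - j) / poch (l + ν + 1) m)

lemma intervalIntegrable_pow_mul_beta {l ν : ℝ} (hl : 0 < l + 1) (hν : 0 < ν) {f : ℝ → ℝ}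
    (hf : Continuous f) :
    IntervalIntegrable (fun u => f u * u ^ (ν - 1) * (1 - u) ^ l) volume 0 1 := by
  have h := (intervalIntegrable_beta hν hl).continuousOn_mul hf.continuousOn
  simpa only [add_sub_cancel_right, mul_assoc] using h

lemma integral_pow_mul_beta {l ν : ℝ} (hl : 0 < l + 1) (hν : 0 < ν) (x v : ℝ) (m : ℕ) :
    ∫ u in (0 : ℝ)..1, (u * v + (1 - u) * x) ^ m * u ^ (ν - 1) * (1 - u) ^ l =
      Real.Gamma (l + 1) * Real.Gamma ν / Real.Gamma (l + 1 + ν) *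
        ∑ j ∈ Finset.range (m + 1), betaMomentCoeff l ν x m j * v ^ j := by
  have h (u : ℝ) : (u * v + (1 - u) * x) ^ m * u ^ (ν - 1) * (1 - u) ^ l =
      ∑ j ∈ Finset.range (m + 1), (m.choose j * x ^ (m - j) * v ^ j) *
        (u ^ j * (1 - u) ^ (m - j) * u ^ (ν - 1) * (1 - u) ^ l) := by
    rw [add_pow, Finset.sum_mul, Finset.sum_mul]
    refine Finset.sum_congr rfl fun j _ => ?_
    rw [mul_pow, mul_pow]
    ring
  simp_rw [h]
  rw [intervalIntegral.integral_finsetSum fun j _ =>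
    (intervalIntegrable_pow_mul_beta hl hν (by fun_prop)).const_mul _, Finset.mul_sum]
  refine Finset.sum_congr rfl fun j hj => ?_
  have h1 := integral_beta_moment hν hl j (m - j)
  simp only [add_sub_cancel_right, ← mul_assoc] at h1
  rw [intervalIntegral.integral_const_mul, h1, betaMomentCoeff,
    Nat.add_sub_cancel' (Finset.mem_range_succ_iff.1 hj), show ν + (l + 1) = l + ν + 1 by ring,
    show l + 1 + ν = l + ν + 1 by ring]
  ring

lemma sum_betaMomentCoeff_mul_integral {ν : ℝ} (l : ℝ) (hν : 0 < ν) (x : ℝ) (m : ℕ) :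
    ∑ j ∈ Finset.range (m + 1), betaMomentCoeff l ν x m j *
        ∫ v in (-1 : ℝ)..1, v ^ j * (1 - v ^ 2) ^ (ν - 1 / 2) =
      Real.Gamma (1 / 2) * Real.Gamma (ν + 1 / 2) / Real.Gamma (ν + 1) *
        (m.factorial / poch (l + ν + 1) m * ∑ i ∈ Finset.range (m / 2 + 1),
          poch (l + 1) (m - 2 * i) / (m - 2 * i).factorial * x ^ (m - 2 * i) *
            (rothe ν i / 4 ^ i)) := by
  rw [sum_range_eq_sum_even fun i => by rw [integral_pow_odd_mul_one_sub_sq_rpow hν, mul_zero],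
    ← mul_assoc, Finset.mul_sum]
  refine Finset.sum_congr rfl fun i hi => ?_
  rw [Finset.mem_range] at hi
  have h1 := (poch_pos (by positivity : 0 < ν + 1) i).ne'
  have h2 : poch ν (2 * i) * (poch (1 / 2) i / poch (ν + 1) i) =
      rothe ν i / 4 ^ i * (2 * i).factorial := by
    rw [mul_div_assoc', div_eq_iff h1, div_mul_eq_mul_div, div_mul_eq_mul_div, eq_div_iff (by simp),
      poch_two_mul_mul_poch_one_half]
    ring
  have h3 : (2 * i).factorial ≠ 0 := Nat.factorial_ne_zero _
  rw [integral_pow_even_mul_one_sub_sq_rpow hν, betaMomentCoeff,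
    Nat.cast_choose ℝ (by omega : 2 * i ≤ m)]
  calc _ = Real.Gamma (1 / 2) * Real.Gamma (ν + 1 / 2) / Real.Gamma (ν + 1) *
        (m.factorial / ((2 * i).factorial * (m - 2 * i).factorial) * x ^ (m - 2 * i) *
          (poch (l + 1) (m - 2 * i) / poch (l + ν + 1) m) *
            (poch ν (2 * i) * (poch (1 / 2) i / poch (ν + 1) i))) := by ring
    _ = _ := by
      rw [h2]
      field_simp

lemma integral_integral_sum_pow {l ν : ℝ} (hl : 0 < l + 1) (hν : 0 < ν) (x : ℝ)
    (S : Finset ℕ) (c : ℕ → ℝ) (e : ℕ → ℕ) :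
    ∫ v in (-1 : ℝ)..1, (∫ u in (0 : ℝ)..1,
        (∑ k ∈ S, c k * (u * v + (1 - u) * x) ^ e k) * u ^ (ν - 1) * (1 - u) ^ l) *
          (1 - v ^ 2) ^ (ν - 1 / 2) =
      Real.Gamma (l + 1) * Real.Gamma ν / Real.Gamma (l + 1 + ν) *
        ∑ k ∈ S, c k * ∑ j ∈ Finset.range (e k + 1), betaMomentCoeff l ν x (e k) j *
          ∫ v in (-1 : ℝ)..1, v ^ j * (1 - v ^ 2) ^ (ν - 1 / 2) := by
  have h (v : ℝ) : (∫ u in (0 : ℝ)..1,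
        (∑ k ∈ S, c k * (u * v + (1 - u) * x) ^ e k) * u ^ (ν - 1) * (1 - u) ^ l) *
          (1 - v ^ 2) ^ (ν - 1 / 2) =
      Real.Gamma (l + 1) * Real.Gamma ν / Real.Gamma (l + 1 + ν) *
        ∑ k ∈ S, c k * ∑ j ∈ Finset.range (e k + 1), betaMomentCoeff l ν x (e k) j *
          (v ^ j * (1 - v ^ 2) ^ (ν - 1 / 2)) := by
    simp only [Finset.sum_mul, mul_assoc (c _)]
    rw [intervalIntegral.integral_finsetSum fun k _ =>
      (intervalIntegrable_pow_mul_beta hl hν (by fun_prop)).const_mul _, Finset.sum_mul,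
      Finset.mul_sum]
    refine Finset.sum_congr rfl fun k _ => ?_
    rw [intervalIntegral.integral_const_mul, integral_pow_mul_beta hl hν]
    simp only [← mul_assoc (betaMomentCoeff _ _ _ _ _), ← Finset.sum_mul]
    ring
  have hi (j : ℕ) := intervalIntegrable_pow_mul_one_sub_sq_rpow (s := ν - 1 / 2) (by linarith) j
  have hi' (k : ℕ) : IntervalIntegrable (fun v : ℝ => ∑ j ∈ Finset.range (e k + 1),
      betaMomentCoeff l ν x (e k) j * (v ^ j * (1 - v ^ 2) ^ (ν - 1 / 2))) volume (-1) 1 := by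
    simpa only [Finset.sum_fn] using IntervalIntegrable.sum (Finset.range (e k + 1))
      fun j _ => (hi j).const_mul (betaMomentCoeff l ν x (e k) j)
  simp_rw [h]
  rw [intervalIntegral.integral_const_mul,
    intervalIntegral.integral_finsetSum fun k _ => (hi' k).const_mul (c k)]
  congr 1
  refine Finset.sum_congr rfl fun k _ => ?_
  rw [intervalIntegral.integral_const_mul,
    intervalIntegral.integral_finsetSum fun j _ => (hi j).const_mul _]
  simp only [intervalIntegral.integral_const_mul]

lemma sum_rothe_convolution (a b : ℝ) (G : ℕ → ℝ) (N : ℕ) :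
    ∑ k ∈ Finset.range (N + 1), ∑ i ∈ Finset.range (N - k + 1), rothe a k * rothe b i * G (k + i) =
      ∑ s ∈ Finset.range (N + 1), rothe (a + b) s * G s := by
  have h := Finset.sum_range_diag_flip (N + 1) fun k i => rothe a k * rothe b i * G (k + i)
  refine Eq.trans (Finset.sum_congr rfl fun k hk => ?_) (h.symm.trans
    (Finset.sum_congr rfl fun s _ => ?_))
  · rw [Nat.sub_add_comm (Finset.mem_range_succ_iff.1 hk)]
  · rw [← sum_rothe_mul_rothe, Finset.sum_mul, Finset.Nat.sum_antidiagonal_eq_sum_range_succ_mk]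
    refine Finset.sum_congr rfl fun k hk => ?_
    rw [Nat.add_sub_cancel' (Finset.mem_range_succ_iff.1 hk)]

theorem stmt4 (l ν : ℝ) (hl : l > -1/2) (hν : 0 < ν) (n : ℕ) (x : ℝ)
    (hx : x ∈ Icc (-1 : ℝ) 1) :
    gegenbauerZ n l x =
      (Real.Gamma (ν + 1) / (Real.Gamma (1/2) * Real.Gamma (ν + 1/2))) *
      (Real.Gamma (l + 1 + ν) / (Real.Gamma (l + 1) * Real.Gamma ν)) *
      ∫ v in (-1 : ℝ)..1,
        (∫ u in (0 : ℝ)..1,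
            gegenbauerZ n (l + ν) (u * v + (1 - u) * x) * u ^ (ν - 1) * (1 - u) ^ l)
          * (1 - v ^ 2) ^ (ν - 1/2) := by
  have hl1 : 0 < l + 1 := by linarith
  simp_rw [gegenbauerZ_eq_sum_rothe n (l + ν), mul_pow (2 : ℝ), ← mul_assoc _ ((2 : ℝ) ^ _)]
  rw [integral_integral_sum_pow hl1 hν]
  simp_rw [sum_betaMomentCoeff_mul_integral l hν]
  have h1 := (Real.Gamma_pos_of_pos hl1).ne'
  have h2 := (Real.Gamma_pos_of_pos hν).ne'
  have h3 := (Real.Gamma_pos_of_pos (add_pos hl1 hν)).ne'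
  have h4 := (Real.Gamma_pos_of_pos (by positivity : 0 < ν + 1)).ne'
  have h5 := (Real.Gamma_pos_of_pos (by positivity : 0 < ν + 1 / 2)).ne'
  have h6 := (Real.Gamma_pos_of_pos (by positivity : (0 : ℝ) < 1 / 2)).ne'
  simp_rw [mul_left_comm _ (Real.Gamma (1 / 2) * Real.Gamma (ν + 1 / 2) / Real.Gamma (ν + 1))]
  rw [← Finset.mul_sum, gegenbauerZ_eq_sum_rothe]
  have key := sum_rothe_convolution (-(n + (l + ν))) ν
    (fun s => poch (l + 1) (n - 2 * s) / (n - 2 * s).factorial * (2 * x) ^ (n - 2 * s)) (n / 2)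
  rw [show -(n + (l + ν)) + ν = -(n + l) by ring] at key
  have hL : ∑ k ∈ Finset.range (n / 2 + 1),
      poch (l + 1) (n - 2 * k) * rothe (-(n + l)) k / (n - 2 * k).factorial *
        (2 * x) ^ (n - 2 * k) = ∑ s ∈ Finset.range (n / 2 + 1), rothe (-(n + l)) s *
          (poch (l + 1) (n - 2 * s) / (n - 2 * s).factorial * (2 * x) ^ (n - 2 * s)) :=
    Finset.sum_congr rfl fun k _ => by ring
  rw [hL, ← key]
  field_simp
  refine Finset.sum_congr rfl fun k hk => ?_
  have hp := (poch_pos (by linarith : 0 < l + ν + 1) (n - 2 * k)).ne'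
  rw [show (n - 2 * k) / 2 = n / 2 - k by omega, mul_assoc, mul_assoc,
    mul_div_cancel_left₀ _ hp, Finset.mul_sum, Finset.mul_sum]
  refine Finset.sum_congr rfl fun i hi => ?_
  rw [Finset.mem_range] at hk hi
  rw [show n - 2 * k - 2 * i = n - 2 * (k + i) by omega,
    show n - 2 * k = n - 2 * (k + i) + 2 * i by omega, pow_add, pow_mul, mul_pow]
  norm_num
  field_simp
end

section
/- Let μ > -1/2, ν + d/2 > 0, and consider on the unit ball B^d ⊂ ℝ^d the weight W_{μ,ν}(x) = ‖x‖^{2ν}(1-‖x‖^2)^{μ-1/2}. For integers n, m, j, k with n - 2j = m - 2k ≥ 0, and Y a spherical harmonic of degree n-2j on S^{d-1}, the polynomials P(x) = P_j^{(μ-1/2, n-2j+ν+(d-2)/2)}(2‖x‖^2-1) Y(x/‖x‖)‖x‖^{n-2j} and Q(x) = P_k^{(μ-1/2, m-2k+ν+(d-2)/2)}(2‖x‖^2-1) Y(x/‖x‖)‖x‖^{m-2k} satisfy ∫_{B^d} P(x) Q(x) W_{μ,ν}(x) dx = 0 whenever j ≠ k. -/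
open Real MeasureTheory Set

/-- The Laplacian of `f : ℝ^d → ℝ`, as the sum of second derivatives along
the coordinate directions. -/
noncomputable def lap {d : ℕ} (f : EuclideanSpace ℝ (Fin d) → ℝ)
    (x : EuclideanSpace ℝ (Fin d)) : ℝ :=
  ∑ i, iteratedDeriv 2 (fun s : ℝ => f (x + s • EuclideanSpace.single i 1)) 0

/-- The Jacobi polynomial `P_n^{(a,b)}` as a polynomial in the variable `(x - 1) / 2`. -/
noncomputable def jacobiPoly (n : ℕ) (a b : ℝ) : Polynomial ℝ :=
  ∑ k ∈ Finset.range (n + 1),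
    Polynomial.C ((poch (a + k + 1) (n - k) * poch (a + b + n + 1) k) /
      ((Nat.factorial k : ℝ) * (Nat.factorial (n - k) : ℝ))) * Polynomial.X ^ k

lemma eval_jacobiPoly (n : ℕ) (a b s : ℝ) :
    (jacobiPoly n a b).eval s = jacobiP n a b (2 * s + 1) := by
  simp [jacobiPoly, jacobiP, Polynomial.eval_finsetSum]

lemma coeff_jacobiPoly (n : ℕ) (a b : ℝ) (k : ℕ) :
    (jacobiPoly n a b).coeff k = if k ≤ n then
      (poch (a + k + 1) (n - k) * poch (a + b + n + 1) k) /
        ((Nat.factorial k : ℝ) * (Nat.factorial (n - k) : ℝ)) else 0 := by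
  simp [jacobiPoly, Polynomial.finsetSum_coeff, Polynomial.coeff_C_mul, Polynomial.coeff_X_pow]

lemma coeff_jacobiPoly_succ (n : ℕ) (a b : ℝ) (k : ℕ) :
    (k + 1) * (a + k + 1) * (jacobiPoly n a b).coeff (k + 1) =
      (n - k) * (n + k + a + b + 1) * (jacobiPoly n a b).coeff k := by
  rw [coeff_jacobiPoly, coeff_jacobiPoly]
  rcases lt_trichotomy k n with h | rfl | h
  · obtain ⟨r, rfl⟩ := Nat.exists_eq_add_of_lt h
    have h1 : k + r + 1 - (k + 1) = r := by omega
    have h2 : k + r + 1 - k = r + 1 := by omega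
    rw [if_pos (by omega), if_pos (by omega), h1, h2, poch_succ, poch_succ_left (a + k + 1),
      Nat.factorial_succ, Nat.factorial_succ]
    push_cast
    rw [show a + (k + 1) + 1 = a + (k : ℝ) + 1 + 1 by ring]
    have := Nat.cast_ne_zero (R := ℝ).2 (Nat.factorial_ne_zero k)
    have := Nat.cast_ne_zero (R := ℝ).2 (Nat.factorial_ne_zero r)
    field_simp
    ring
  · simp
  · rw [if_neg (by omega), if_neg (by omega)]
    simp

open Polynomial in
/-- The Jacobi differential equation. -/
lemma jacobiPoly_ode (n : ℕ) (a b : ℝ) :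
    X * (X + 1) * derivative (derivative (jacobiPoly n a b)) +
      (C (a + 1) + C (a + b + 2) * X) * derivative (jacobiPoly n a b) =
      C (n * (n + a + b + 1)) * jacobiPoly n a b := by
  ext k
  have h := coeff_jacobiPoly_succ n a b k
  simp only [add_mul, mul_add, mul_one, mul_assoc, coeff_add, coeff_C_mul]
  rcases k with _ | _ | k
  · simp only [mul_coeff_zero, coeff_X_zero, coeff_derivative]
    push_cast at h ⊢
    linear_combination h
  · simp only [coeff_X_mul, mul_coeff_zero, coeff_X_zero, coeff_derivative]
    push_cast at h ⊢
    linear_combination h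
  · simp only [coeff_X_mul, coeff_derivative]
    push_cast at h ⊢
    linear_combination h

lemma intervalIntegrable_rpow_mul_one_sub_rpow {a b : ℝ} (ha : -1 < a) (hb : -1 < b) :
    IntervalIntegrable (fun t : ℝ ↦ t ^ b * (1 - t) ^ a) volume 0 1 := by
  have h := (Complex.betaIntegral_convergent (u := ((b + 1 : ℝ) : ℂ)) (v := ((a + 1 : ℝ) : ℂ))
    (by simp; linarith) (by simp; linarith)).norm
  refine h.congr_uIoo fun t ht ↦ ?_
  rw [uIoo_of_le zero_le_one] at ht
  have h1 : 0 < 1 - t := by linarith [ht.2]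
  have h2 : 1 - (t : ℂ) = ((1 - t : ℝ) : ℂ) := by push_cast; rfl
  simp [h2, -Complex.ofReal_sub, abs_of_pos ht.1, abs_of_pos h1]

open Polynomial in
/-- Orthogonality of Jacobi polynomials of distinct degrees. -/
lemma integral_jacobiPoly_mul {a b : ℝ} (ha : -1 < a) (hb : -1 < b) {j k : ℕ} (hjk : j ≠ k) :
    ∫ t in (0 : ℝ)..1, t ^ b * (1 - t) ^ a *
      ((jacobiPoly j a b).eval (t - 1) * (jacobiPoly k a b).eval (t - 1)) = 0 := by
  set p := jacobiPoly j a b with hp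
  set q := jacobiPoly k a b with hq
  set c : ℝ := j * (j + a + b + 1) - k * (k + a + b + 1) with hc
  have hc0 : c ≠ 0 := by
    have h1 : c = (j - k) * (j + k + a + b + 1) := by rw [hc]; ring
    have h2 : (1 : ℝ) ≤ j + k := by exact_mod_cast (by omega : 1 ≤ j + k)
    rw [h1]
    exact mul_ne_zero (sub_ne_zero.2 (Nat.cast_injective.ne hjk)) (by linarith)
  have hderiv : ∀ t ∈ Ioo (0 : ℝ) 1, HasDerivAt
      (fun t ↦ t ^ (b + 1) * (1 - t) ^ (a + 1) *
        (p.eval (t - 1) * (derivative q).eval (t - 1) -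
          (derivative p).eval (t - 1) * q.eval (t - 1)))
      (c * (t ^ b * (1 - t) ^ a * (p.eval (t - 1) * q.eval (t - 1)))) t := by
    intro t ht
    have h1 : 0 < 1 - t := by linarith [ht.2]
    have hs : HasDerivAt (fun t : ℝ ↦ t - 1) 1 t := (hasDerivAt_id t).sub_const 1
    have hs' : HasDerivAt (fun t : ℝ ↦ 1 - t) (-1) t := (hasDerivAt_id t).const_sub 1
    have hd (r : ℝ[X]) : HasDerivAt (fun t ↦ r.eval (t - 1)) ((derivative r).eval (t - 1)) t := by
      exact ((r.hasDerivAt (t - 1)).comp t hs).congr_deriv (mul_one _)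
    have key := (((hasDerivAt_id t).rpow_const (p := b + 1) (Or.inl ht.1.ne')).mul
      (hs'.rpow_const (p := a + 1) (Or.inl h1.ne'))).mul
      (((hd p).mul (hd (derivative q))).sub ((hd (derivative p)).mul (hd q)))
    refine key.congr_deriv ?_
    have op := congrArg (Polynomial.eval (t - 1)) (jacobiPoly_ode j a b)
    have oq := congrArg (Polynomial.eval (t - 1)) (jacobiPoly_ode k a b)
    rw [← hp] at op
    rw [← hq] at oq
    simp only [eval_add, eval_mul, eval_X, eval_C, eval_one] at op oq
    simp only [id, Pi.mul_apply, Pi.sub_apply, add_sub_cancel_right]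
    rw [rpow_add_one ht.1.ne', rpow_add_one h1.ne', hc]
    linear_combination t ^ b * (1 - t) ^ a * (q.eval (t - 1) * op - p.eval (t - 1) * oq)
  have hcont : ContinuousOn (fun t : ℝ ↦ t ^ (b + 1) * (1 - t) ^ (a + 1) *
        (p.eval (t - 1) * (derivative q).eval (t - 1) -
          (derivative p).eval (t - 1) * q.eval (t - 1))) (Icc 0 1) := by
    have h1 : Continuous fun t : ℝ ↦ t ^ (b + 1) := continuous_id.rpow_const
      fun _ ↦ Or.inr (by linarith)
    have h2 : Continuous fun t : ℝ ↦ (1 - t) ^ (a + 1) :=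
      (continuous_const.sub continuous_id).rpow_const fun _ ↦ Or.inr (by linarith)
    fun_prop
  have hint : IntervalIntegrable
      (fun t ↦ c * (t ^ b * (1 - t) ^ a * (p.eval (t - 1) * q.eval (t - 1)))) volume 0 1 :=
    ((intervalIntegrable_rpow_mul_one_sub_rpow ha hb).mul_continuousOn
      (by fun_prop)).const_mul c
  have h := intervalIntegral.integral_eq_sub_of_hasDerivAt_of_le zero_le_one hcont hderiv hint
  rw [intervalIntegral.integral_const_mul] at h
  simpa [hc0, zero_rpow (by linarith : a + 1 ≠ 0), zero_rpow (by linarith : b + 1 ≠ 0)] using h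

/-- Integration in polar coordinates of a radial function times a homogeneous function. -/
lemma integral_fun_norm_mul_homogeneous {E : Type*} [NormedAddCommGroup E] [NormedSpace ℝ E]
    [MeasurableSpace E] [BorelSpace E] [FiniteDimensional ℝ E] [Nontrivial E] (ρ : Measure E)
    [ρ.IsAddHaarMeasure] (f : ℝ → ℝ) (h : E → ℝ) (p : ℕ)
    (hh : ∀ c : ℝ, 0 < c → ∀ x, h (c • x) = c ^ p * h x) :
    ∫ x, f ‖x‖ * h x ∂ρ = (∫ u, h u ∂ρ.toSphere) *
      ∫ r in Ioi (0 : ℝ), r ^ (Module.finrank ℝ E - 1) * (f r * r ^ p) := by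
  calc
    ∫ x, f ‖x‖ * h x ∂ρ = ∫ x : ({(0)}ᶜ : Set E), f ‖x.1‖ * h x.1 ∂(ρ.comap (↑)) := by
      rw [integral_subtype_comap (measurableSet_singleton _).compl fun x ↦ f ‖x‖ * h x,
        restrict_compl_singleton]
    _ = ∫ x, h x.1 * (f x.2 * (x.2 : ℝ) ^ p)
          ∂ρ.toSphere.prod (.volumeIoiPow (Module.finrank ℝ E - 1)) := by
      rw [← ρ.measurePreserving_homeomorphUnitSphereProd.integral_comp
        (Homeomorph.measurableEmbedding _)]
      refine integral_congr_ae (.of_forall fun x ↦ ?_)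
      have hx : 0 < ‖x.1‖ := norm_pos_iff.2 x.2
      have := hh ‖x.1‖ hx (‖x.1‖⁻¹ • x.1)
      rw [smul_inv_smul₀ hx.ne'] at this
      simp only [homeomorphUnitSphereProd_apply_snd_coe, homeomorphUnitSphereProd_apply_fst_coe]
      rw [this]
      ring
    _ = (∫ u, h u ∂ρ.toSphere) * ∫ r : Ioi (0 : ℝ), f r * (r : ℝ) ^ p
          ∂.volumeIoiPow (Module.finrank ℝ E - 1) :=
      integral_prod_mul (fun u : Metric.sphere (0 : E) 1 ↦ h u)
        (fun r : Ioi (0 : ℝ) ↦ f r * (r : ℝ) ^ p)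
    _ = _ := by
      congr 1
      simp only [Measure.volumeIoiPow, ENNReal.ofReal]
      rw [integral_withDensity_eq_integral_smul,
        integral_subtype_comap measurableSet_Ioi
          fun r ↦ Real.toNNReal (r ^ (Module.finrank ℝ E - 1)) • (f r * r ^ p),
        setIntegral_congr_fun measurableSet_Ioi fun x hx ↦ ?_]
      · rw [NNReal.smul_def, Real.coe_toNNReal _ (pow_nonneg hx.out.le _), smul_eq_mul]
      · exact (measurable_subtype_coe.pow_const _).real_toNNReal

/-- The substitution `t = r ^ 2` on the unit interval. -/
lemma integral_Ioo_comp_sq (g : ℝ → ℝ) :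
    ∫ r in Ioo (0 : ℝ) 1, 2 * r * g (r ^ 2) = ∫ t in Ioo (0 : ℝ) 1, g t := by
  have h := integral_comp_rpow_Ioi_of_pos (g := (Iio (1 : ℝ)).indicator g) two_pos
  rw [setIntegral_indicator measurableSet_Iio, Ioi_inter_Iio] at h
  rw [← h, ← Ioi_inter_Iio, ← setIntegral_indicator measurableSet_Iio]
  refine setIntegral_congr_fun measurableSet_Ioi fun r (hr : 0 < r) ↦ ?_
  have : r ^ 2 < 1 ↔ r < 1 := by rw [sq_lt_one_iff₀ hr.le]
  by_cases h1 : r < 1 <;> simp [indicator, this, h1, show (2 : ℝ) - 1 = 1 by norm_num]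

theorem stmt14 (d : ℕ) (hd : 2 ≤ d) (μ ν : ℝ) (hμ : μ > -1/2) (hν : ν + d / 2 > 0)
    (n m j k : ℕ) (hj : 2 * j ≤ n) (hk : 2 * k ≤ m) (hnm : n - 2 * j = m - 2 * k)
    (hjk : j ≠ k)
    (Y : EuclideanSpace ℝ (Fin d) → ℝ)
    (hpoly : ∃ P : MvPolynomial (Fin d) ℝ, ∀ x, Y x = MvPolynomial.eval (fun i => x i) P)
    (hharm : ∀ x, lap Y x = 0)
    (hhom : ∀ (c : ℝ) (x : EuclideanSpace ℝ (Fin d)), Y (c • x) = c ^ (n - 2 * j) * Y x) :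
    ∫ x in Metric.ball (0 : EuclideanSpace ℝ (Fin d)) 1,
        (jacobiP j (μ - 1/2) ((n : ℝ) - 2 * j + ν + ((d : ℝ) - 2) / 2) (2 * ‖x‖ ^ 2 - 1) * Y x)
          * (jacobiP k (μ - 1/2) ((m : ℝ) - 2 * k + ν + ((d : ℝ) - 2) / 2) (2 * ‖x‖ ^ 2 - 1) * Y x)
          * (‖x‖ ^ (2 * ν) * (1 - ‖x‖ ^ 2) ^ (μ - 1/2)) = 0 := by
  have : Nontrivial (EuclideanSpace ℝ (Fin d)) := by
    have : Nonempty (Fin d) := ⟨⟨0, by omega⟩⟩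
    infer_instance
  set N := n - 2 * j with hN
  set a : ℝ := μ - 1 / 2 with ha
  set b : ℝ := N + ν + ((d : ℝ) - 2) / 2 with hb
  have hjb : (n : ℝ) - 2 * j + ν + ((d : ℝ) - 2) / 2 = b := by
    rw [hb, hN, Nat.cast_sub hj]
    push_cast
    ring
  have hkb : (m : ℝ) - 2 * k + ν + ((d : ℝ) - 2) / 2 = b := by
    rw [hb, hnm, Nat.cast_sub hk]
    push_cast
    ring
  have ha1 : -1 < a := by linarith
  have hb1 : -1 < b := by linarith [N.cast_nonneg (α := ℝ)]
  set f : ℝ → ℝ := (Iio (1 : ℝ)).indicator fun r ↦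
    jacobiP j a b (2 * r ^ 2 - 1) * jacobiP k a b (2 * r ^ 2 - 1) *
      (r ^ (2 * ν) * (1 - r ^ 2) ^ a) with hf
  have hradial : ∫ r in Ioi (0 : ℝ), r ^ (d - 1) * (f r * r ^ (2 * N)) = 0 := by
    have h := integral_jacobiPoly_mul ha1 hb1 hjk
    rw [intervalIntegral.integral_of_le zero_le_one, integral_Ioc_eq_integral_Ioo,
      ← integral_Ioo_comp_sq] at h
    refine (mul_eq_zero_iff_left (two_ne_zero (α := ℝ))).1 (Eq.trans ?_ h)
    rw [← integral_const_mul, ← Ioi_inter_Iio, ← setIntegral_indicator measurableSet_Iio]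
    refine setIntegral_congr_fun measurableSet_Ioi fun r (hr : 0 < r) ↦ ?_
    by_cases h1 : r < 1
    · have hpow : r * (r ^ 2) ^ b = r ^ (d - 1) * r ^ (2 * N) * r ^ (2 * ν) := by
        rw [← rpow_natCast r 2, ← rpow_mul hr.le, ← rpow_natCast r (d - 1),
          ← rpow_natCast r (2 * N), ← rpow_add hr, ← rpow_add hr]
        nth_rw 1 [← rpow_one r]
        rw [← rpow_add hr, hb, Nat.cast_sub (by omega : 1 ≤ d)]
        congr 1
        push_cast
        ring
      simp only [hf, indicator_of_mem (mem_Iio.2 h1), eval_jacobiPoly]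
      rw [show 2 * (r ^ 2 - 1) + 1 = 2 * r ^ 2 - 1 by ring]
      linear_combination (-2 * (1 - r ^ 2) ^ a * jacobiP j a b (2 * r ^ 2 - 1) *
        jacobiP k a b (2 * r ^ 2 - 1)) * hpow
    · simp [hf, indicator, h1]
  have hpolar := integral_fun_norm_mul_homogeneous
    (volume : Measure (EuclideanSpace ℝ (Fin d))) f (fun x ↦ Y x ^ 2) (2 * N)
    (fun c _ x ↦ by rw [hhom]; ring)
  rw [finrank_euclideanSpace_fin, hradial, mul_zero] at hpolar
  rw [← hpolar, ← integral_indicator Metric.isOpen_ball.measurableSet, hjb, hkb]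
  refine integral_congr_ae (.of_forall fun x ↦ ?_)
  by_cases hx : ‖x‖ < 1
  · simp only [hf, indicator_of_mem (mem_Iio.2 hx), indicator_of_mem (mem_ball_zero_iff.2 hx)]
    ring
  · simp [hf, indicator, hx]
end
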